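/- Let X = (ℝ/ℤ)² with the Lebesgue (Haar) probability measure μ, let f(x,y) = (x+y,y), φ(x,y) = e(x), and for each prime p let a_p be an integer with 0 ≤ a_p < p; set s_p(x,y) = (1/p) Σ_{0 ≤ n < p} e(−n a_p/p) φ(fⁿ(x,y)). If P is an infinite set of primes such that Σ_{p ∈ P} (log p)/p < +∞, then for μ-almost every (x,y) ∈ X, s_p(x,y) → 0 as p → +∞ along P. -/

import Mathlib

open MeasureTheory
open scoped Real

/-- `e(t) = exp(2πit)`. -/
noncomputable def e (t : ℝ) : ℂ := Complex.exp (2 * Real.pi * Complex.I * t)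

/-- `s_p(x,y) = (1/p) Σ_{0 ≤ n < p} e(-n a_p/p) φ(fⁿ(x,y))` on the torus `X = (ℝ/ℤ)²`,
where `f(x,y) = (x+y,y)` (so `fⁿ(x,y) = (x+ny,y)`) and `φ(x,y) = e(x)`. -/
noncomputable def sTorus (a : ℕ → ℕ) (p : ℕ) (z : UnitAddCircle × UnitAddCircle) : ℂ :=
  ((p : ℂ))⁻¹ * ∑ n ∈ Finset.range p,
    e (-(n : ℝ) * (a p : ℝ) / (p : ℝ)) * (AddCircle.toCircle (z.1 + n • z.2) : ℂ)

theorem integral_norm_sq_sum_smul_fourier {T : ℝ} [Fact (0 < T)] (s : Finset ℤ) (c : ℤ → ℂ) :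
    ∫ y : AddCircle T, ‖∑ n ∈ s, c n * fourier n y‖ ^ 2 ∂AddCircle.haarAddCircle
      = ∑ n ∈ s, ‖c n‖ ^ 2 := by
  set F : C(AddCircle T, ℂ) := ∑ n ∈ s, c n • fourier n with hF
  have h_apply (y : AddCircle T) : F y = ∑ n ∈ s, c n * fourier n y := by
    simp [hF, ContinuousMap.sum_apply]
  have h_toLp : ContinuousMap.toLp (E := ℂ) 2 AddCircle.haarAddCircle ℂ F
      = ∑ n ∈ s, c n • fourierLp (T := T) 2 n := by
    simp [hF, map_sum, map_smul, fourierLp]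
  have h_inner := ContinuousMap.inner_toLp (𝕜 := ℂ) (AddCircle.haarAddCircle (T := T)) F F
  rw [h_toLp, orthonormal_fourier.inner_sum] at h_inner
  have h_mul (z : ℂ) : z * (starRingEnd ℂ) z = ((‖z‖ ^ 2 : ℝ) : ℂ) := by
    rw [Complex.mul_conj, Complex.normSq_eq_norm_sq]
  simp_rw [mul_comm ((starRingEnd ℂ) _), h_mul, integral_complex_ofReal, h_apply] at h_inner
  exact_mod_cast h_inner.symm

theorem norm_e (t : ℝ) : ‖e t‖ = 1 := by
  have : e t = Complex.exp (((2 * π * t : ℝ) : ℂ) * Complex.I) := by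
    rw [e]; congr 1; push_cast; ring
  rw [this, Complex.norm_exp_ofReal_mul_I]

theorem norm_sTorus_eq (a : ℕ → ℕ) (p : ℕ) (z : UnitAddCircle × UnitAddCircle) :
    ‖sTorus a p z‖ = ‖sTorus a p (0, z.2)‖ := by
  have : sTorus a p z = (AddCircle.toCircle z.1 : ℂ) * sTorus a p (0, z.2) := by
    simp only [sTorus, AddCircle.toCircle_add, Circle.coe_mul, Finset.mul_sum, zero_add]
    exact Finset.sum_congr rfl fun _ _ => by ring
  rw [this, norm_mul, Circle.norm_coe, one_mul]

theorem sTorus_zero_eq_sum_fourier (a : ℕ → ℕ) (p : ℕ) (y : UnitAddCircle) :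
    sTorus a p (0, y) = ∑ n ∈ (Finset.range p).map (Nat.castEmbedding (R := ℤ)),
      ((p : ℂ)⁻¹ * e (-((n : ℤ) : ℝ) * (a p : ℝ) / (p : ℝ))) * fourier n y := by
  simp [sTorus, Finset.mul_sum, mul_assoc]

theorem continuous_sTorus_zero (a : ℕ → ℕ) (p : ℕ) :
    Continuous fun y : UnitAddCircle => sTorus a p (0, y) := by
  simp only [sTorus_zero_eq_sum_fourier]
  fun_prop

theorem integral_norm_sq_sTorus_zero (a : ℕ → ℕ) (p : ℕ) :
    ∫ y : UnitAddCircle, ‖sTorus a p (0, y)‖ ^ 2 = (p : ℝ)⁻¹ := by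
  have h_vol : (volume : Measure UnitAddCircle) = AddCircle.haarAddCircle := by
    simp [AddCircle.volume_eq_smul_haarAddCircle]
  simp_rw [h_vol, sTorus_zero_eq_sum_fourier]
  rw [integral_norm_sq_sum_smul_fourier]
  rcases eq_or_ne (p : ℝ) 0 with hp | hp
  · simp [norm_e, hp]
  · simp [norm_e]
    field_simp

theorem summable_inv_of_summable_log_div (P : Set ℕ) (hP : ∀ p ∈ P, p.Prime)
    (hsum : Summable fun p : P => Real.log ((p : ℕ) : ℝ) / ((p : ℕ) : ℝ)) :
    Summable fun p : P => ((p : ℕ) : ℝ)⁻¹ := by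
  refine Summable.of_nonneg_of_le (fun _ => by positivity) (fun p => ?_)
    (hsum.mul_left (Real.log 2)⁻¹)
  have h2 : (2 : ℝ) ≤ ((p : ℕ) : ℝ) := by exact_mod_cast (hP p p.2).two_le
  have h_log : Real.log 2 ≤ Real.log ((p : ℕ) : ℝ) := Real.log_le_log (by norm_num) h2
  have h_pos : 0 < Real.log 2 := Real.log_pos (by norm_num)
  rw [inv_mul_eq_div, div_div, inv_eq_one_div, div_le_div_iff₀ (by linarith) (by positivity)]
  nlinarith

theorem ae_summable_of_summable_integral {α ι : Type*} [Countable ι] [MeasurableSpace α]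
    {μ : Measure α} {f : ι → α → ℝ} (hf : ∀ i, Integrable (f i) μ) (hf0 : ∀ i x, 0 ≤ f i x)
    (hs : Summable fun i => ∫ x, f i x ∂μ) : ∀ᵐ x ∂μ, Summable fun i => f i x := by
  have h_meas (i : ι) : AEMeasurable (fun x => ENNReal.ofReal (f i x)) μ :=
    (hf i).aestronglyMeasurable.aemeasurable.ennreal_ofReal
  have h_fin : ∫⁻ x, ∑' i, ENNReal.ofReal (f i x) ∂μ ≠ ⊤ := by
    rw [lintegral_tsum h_meas]
    simp_rw [← fun i => ofReal_integral_eq_lintegral_ofReal (hf i) (ae_of_all _ (hf0 i))]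
    exact hs.tsum_ofReal_ne_top
  filter_upwards [ae_lt_top' (AEMeasurable.tsum h_meas) h_fin] with x hx
  simpa [hf0] using ENNReal.summable_toReal hx.ne

/-- If `P` is an infinite set of primes with `Σ_{p ∈ P} (log p)/p < ∞`, then for almost
every `(x,y)` in the torus `X = (ℝ/ℤ)²` (with its Haar probability measure),
`s_p(x,y) → 0` as `p → ∞` along `P`. -/
theorem sTorus_ae_tendsto_zero (a : ℕ → ℕ) (ha : ∀ p : ℕ, p.Prime → a p < p)
    (P : Set ℕ) (hP : ∀ p ∈ P, p.Prime) (hPinf : P.Infinite)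
    (hsum : Summable fun p : P => Real.log ((p : ℕ) : ℝ) / ((p : ℕ) : ℝ)) :
    ∀ᵐ z ∂(volume : Measure (UnitAddCircle × UnitAddCircle)),
      Filter.Tendsto (fun p : ℕ => sTorus a p z)
        (Filter.atTop ⊓ Filter.principal P) (nhds 0) := by
  have h_fiber : ∀ᵐ y ∂(volume : Measure UnitAddCircle),
      Summable fun p : P => ‖sTorus a p (0, y)‖ ^ 2 := by
    refine ae_summable_of_summable_integral (fun p => ?_) (fun _ _ => by positivity) ?_
    · exact ((continuous_sTorus_zero a p).norm.pow 2).integrable_of_hasCompactSupport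
        (HasCompactSupport.of_compactSpace _)
    · simpa only [integral_norm_sq_sTorus_zero] using summable_inv_of_summable_log_div P hP hsum
  have h_snd := (Measure.quasiMeasurePreserving_snd (μ := (volume : Measure UnitAddCircle))
    (ν := (volume : Measure UnitAddCircle))).ae h_fiber
  filter_upwards [h_snd] with z hz
  have h_sq := hz.tendsto_cofinite_zero
  have h_norm : Filter.Tendsto (fun p : P => sTorus a p z) Filter.cofinite (nhds 0) := by
    rw [tendsto_zero_iff_norm_tendsto_zero]
    simpa [← norm_sTorus_eq, Real.sqrt_sq] using h_sq.sqrt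
  rw [← Subtype.val_injective.comap_cofinite_eq, Nat.cofinite_eq_atTop] at h_norm
  rw [← Subtype.range_coe (s := P), ← Filter.map_comap, Filter.tendsto_map'_iff]
  exact h_norm
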